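/- arXiv:quant-ph/0607056 — 2 statements merged into one kernel-verified Lean document; each statement's English description precedes it below -/
import Mathlib

section
/- The one-way key rate function R(e) = 1 − H₂(e) − H₂(2e) for the three-state protocol with α = 0 (where the phase error rate bound is e_p = 2·e_b) satisfies R(0.075) > 0 and R(0.08) < 0; hence the threshold bit error rate at which R vanishes lies strictly between 0.075 and 0.08. -/
/-- The binary entropy function `H₂(x) = −x·log₂ x − (1−x)·log₂(1−x)`. -/
noncomputable def H2 (x : ℝ) : ℝ := -x * Real.logb 2 x - (1 - x) * Real.logb 2 (1 - x)

/-- The base-two binary entropy is the natural one divided by `log 2`. -/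
lemma H2_eq_div (x : ℝ) :
    H2 x = (-x * Real.log x - (1 - x) * Real.log (1 - x)) / Real.log 2 := by
  unfold H2 Real.logb
  ring

/-- For the three-state protocol with `α = 0` (so `e_p = 2·e_b`), the
one-way key rate `R(e) = 1 − H₂(e) − H₂(2e)` is positive at `e = 0.075` and negative at
`e = 0.08`; hence the threshold QBER lies strictly between `0.075` and `0.08`. -/
theorem key_rate_threshold_alpha_zero :
    0 < 1 - H2 0.075 - H2 (2 * 0.075) ∧ 1 - H2 0.08 - H2 (2 * 0.08) < 0 := by
  have hpos : 0 < Real.log 2 := Real.log_pos (by norm_num)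
  have two_gt := Real.log_two_gt_d9
  have two_lt := Real.log_two_lt_d9
  have three_gt := Real.log_three_gt_d9
  have three_lt := Real.log_three_lt_d9
  have five_gt := Real.log_five_gt_d9
  have five_lt := Real.log_five_lt_d9
  constructor
  · have e₁ : Real.log 0.075 = Real.log 3 - 3 * Real.log 2 - Real.log 5 := by
      rw [show (0.075 : ℝ) = 3 / 2 ^ 3 / 5 by norm_num, Real.log_div (by norm_num) (by norm_num),
        Real.log_div (by norm_num) (by norm_num), Real.log_pow]
      norm_num
    have e₂ : Real.log 0.15 = Real.log 3 - 2 * Real.log 2 - Real.log 5 := by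
      rw [show (0.15 : ℝ) = 3 / 2 ^ 2 / 5 by norm_num, Real.log_div (by norm_num) (by norm_num),
        Real.log_div (by norm_num) (by norm_num), Real.log_pow]
      norm_num
    have e₃ : Real.log 0.925 = Real.log (37 / 36) + 2 * Real.log 3 - Real.log 2 - Real.log 5 := by
      rw [show (0.925 : ℝ) = 37 / 36 * 3 ^ 2 / 2 / 5 by norm_num,
        Real.log_div (by norm_num) (by norm_num), Real.log_div (by norm_num) (by norm_num),
        Real.log_mul (by norm_num) (by norm_num), Real.log_pow]
      norm_num
    have e₄ : Real.log 0.85 = Real.log (17 / 16) + 2 * Real.log 2 - Real.log 5 := by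
      rw [show (0.85 : ℝ) = 17 / 16 * 2 ^ 2 / 5 by norm_num,
        Real.log_div (by norm_num) (by norm_num),
        Real.log_mul (by norm_num) (by norm_num), Real.log_pow]
      norm_num
    have b₃ := Real.one_sub_inv_le_log_of_pos (show (0 : ℝ) < 37 / 36 by norm_num)
    have b₄ := Real.one_sub_inv_le_log_of_pos (show (0 : ℝ) < 17 / 16 by norm_num)
    rw [H2_eq_div, H2_eq_div, show (2 * 0.075 : ℝ) = 0.15 by norm_num,
      show (1 - 0.075 : ℝ) = 0.925 by norm_num, show (1 - 0.15 : ℝ) = 0.85 by norm_num,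
      sub_sub, ← add_div, sub_pos, div_lt_one hpos, e₁, e₂, e₃, e₄]
    norm_num at *
    linarith
  · have e₁ : Real.log 0.08 = Real.log 2 - 2 * Real.log 5 := by
      rw [show (0.08 : ℝ) = 2 / 5 ^ 2 by norm_num, Real.log_div (by norm_num) (by norm_num),
        Real.log_pow]
      norm_num
    have e₂ : Real.log 0.16 = 2 * Real.log 2 - 2 * Real.log 5 := by
      rw [show (0.16 : ℝ) = 2 ^ 2 / 5 ^ 2 by norm_num, Real.log_div (by norm_num) (by norm_num),
        Real.log_pow, Real.log_pow]
      norm_num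
    have e₃ : Real.log 0.92 =
        Real.log (23 / 24) + Real.log 3 + 3 * Real.log 2 - 2 * Real.log 5 := by
      rw [show (0.92 : ℝ) = 23 / 24 * 3 * 2 ^ 3 / 5 ^ 2 by norm_num,
        Real.log_div (by norm_num) (by norm_num), Real.log_mul (by norm_num) (by norm_num),
        Real.log_mul (by norm_num) (by norm_num), Real.log_pow, Real.log_pow]
      norm_num
    have e₄ : Real.log 0.84 = Real.log (21 / 20) + 2 * Real.log 2 - Real.log 5 := by
      rw [show (0.84 : ℝ) = 21 / 20 * 2 ^ 2 / 5 by norm_num,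
        Real.log_div (by norm_num) (by norm_num),
        Real.log_mul (by norm_num) (by norm_num), Real.log_pow]
      norm_num
    have b₃ := Real.log_le_sub_one_of_pos (show (0 : ℝ) < 23 / 24 by norm_num)
    have b₄ := Real.log_le_sub_one_of_pos (show (0 : ℝ) < 21 / 20 by norm_num)
    rw [H2_eq_div, H2_eq_div, show (2 * 0.08 : ℝ) = 0.16 by norm_num,
      show (1 - 0.08 : ℝ) = 0.92 by norm_num, show (1 - 0.16 : ℝ) = 0.84 by norm_num,
      sub_sub, ← add_div, sub_neg, one_lt_div hpos, e₁, e₂, e₃, e₄]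
    norm_num at *
    linarith
end

section
/- The one-way key rate function R(e) = 1 − H₂(e) − H₂(5e) for the three-state protocol in the symmetric case α = e_b (where the phase error rate bound is e_p = 5·e_b) satisfies R(0.0425) > 0 and R(0.043) < 0; hence the threshold bit error rate at which R vanishes lies strictly between 0.0425 and 0.043. -/
/-- The key rate at error rates `a / n` and `c / m`, with denominators cleared. -/
theorem key_rate_mul_log_two {a b n c d m : ℝ} (ha : 0 < a) (hb : 0 < b) (hc : 0 < c) (hd : 0 < d)
    (hn : a + b = n) (hm : c + d = m) :
    (1 - H2 (a / n) - H2 (c / m)) * Real.log 2 =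
      Real.log 2 + (a / n * Real.log a + b / n * Real.log b - Real.log n) +
        (c / m * Real.log c + d / m * Real.log d - Real.log m) := by
  have hn0 : n ≠ 0 := by linarith
  have hm0 : m ≠ 0 := by linarith
  have h2 : Real.log 2 ≠ 0 := (Real.log_pos one_lt_two).ne'
  have hbn : 1 - a / n = b / n := by field_simp; linarith
  have hdm : 1 - c / m = d / m := by field_simp; linarith
  simp only [H2, hbn, hdm, Real.logb, Real.log_div ha.ne' hn0, Real.log_div hb.ne' hn0,
    Real.log_div hc.ne' hm0, Real.log_div hd.ne' hm0]
  field_simp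
  subst hn hm
  ring

/-- For the three-state protocol in the symmetric case `α = e_b` (so
`e_p = 5·e_b`), the one-way key rate `R(e) = 1 − H₂(e) − H₂(5e)` is positive at
`e = 0.0425` and negative at `e = 0.043`; hence the threshold QBER lies strictly between
`0.0425` and `0.043`. -/
theorem key_rate_threshold_symmetric :
    0 < 1 - H2 0.0425 - H2 (5 * 0.0425) ∧ 1 - H2 0.043 - H2 (5 * 0.043) < 0 := by
  have h2 : 0 < Real.log 2 := Real.log_pos one_lt_two
  constructor
  · have key : Real.log ((400 : ℝ) ^ 400 * 80 ^ 400) <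
        Real.log (2 ^ 400 * 17 ^ 17 * 383 ^ 383 * 17 ^ 85 * 63 ^ 315) :=
      Real.log_lt_log (by positivity) (by set_option exponentiation.threshold 1000 in norm_num)
    have h := key_rate_mul_log_two (a := 17) (b := 383) (n := 400) (c := 17) (d := 63) (m := 80)
      (by norm_num) (by norm_num) (by norm_num) (by norm_num) (by norm_num) (by norm_num)
    rw [show (0.0425 : ℝ) = 17 / 400 by norm_num, show (5 * (17 / 400) : ℝ) = 17 / 80 by norm_num]
    refine pos_of_mul_pos_left ?_ h2.le
    rw [h]
    repeat rw [Real.log_mul (by positivity) (by positivity)] at key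
    simp only [Real.log_pow] at key
    push_cast at key
    linarith
  · have key : Real.log ((2 : ℝ) ^ 1000 * 43 ^ 43 * 957 ^ 957 * 43 ^ 215 * 157 ^ 785) <
        Real.log (1000 ^ 1000 * 200 ^ 1000) :=
      Real.log_lt_log (by positivity) (by set_option exponentiation.threshold 1000 in norm_num)
    have h := key_rate_mul_log_two (a := 43) (b := 957) (n := 1000) (c := 43) (d := 157) (m := 200)
      (by norm_num) (by norm_num) (by norm_num) (by norm_num) (by norm_num) (by norm_num)
    rw [show (0.043 : ℝ) = 43 / 1000 by norm_num, show (5 * (43 / 1000) : ℝ) = 43 / 200 by norm_num]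
    refine neg_of_mul_neg_left ?_ h2.le
    rw [h]
    repeat rw [Real.log_mul (by positivity) (by positivity)] at key
    simp only [Real.log_pow] at key
    push_cast at key
    linarith
end
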